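/- arXiv:1412.1937 — 2 statements merged into one kernel-verified Lean document; each statement's English description precedes it below -/
import Mathlib

section
/- Let c : ℤ → ℂ take values in {−1, 1} and let s ≥ 1. Then for every i ∈ ℤ, the matrix entry ((A^c)^s)_{i, i+s} = 1, and for every j ∈ ℤ such that j is not of the form i − s + 2t for some t ∈ {0, 1, …, s}, the matrix entry ((A^c)^s)_{i, j} = 0. -/
open scoped BigOperators

/-- `triDet n a` is the determinant of the `n×n` tridiagonal matrix with `-X` in every
diagonal entry, `1` in every first-superdiagonal entry and `a 0, …, a (n-2)` in the
first-subdiagonal entries, viewed as a polynomial in `X` (for `n = 0` it is `1`).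
With 0-based indexing, `triDet n (fun j => a (j+1))`-style shifts recover the paper's
`Δ(λ; a_1, …, a_{n−1})`. -/
noncomputable def triDet (n : ℕ) (a : ℕ → ℂ) : Polynomial ℂ :=
  (Matrix.of fun i j : Fin n =>
    if (i : ℕ) = (j : ℕ) then -Polynomial.X
    else if (i : ℕ) + 1 = (j : ℕ) then 1
    else if (i : ℕ) = (j : ℕ) + 1 then Polynomial.C (a (j : ℕ))
    else 0).det

/-- The polynomial `p_k` for an `m`-tuple `k`, with 0-based indexing: `k 0 = k_1`, …,
`k (m-1) = k_m`.  `p_k = (-1)^m (Δ(λ; k_1, …, k_{m−1}) − k_m Δ(λ; k_2, …, k_{m−2}))`. -/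
noncomputable def pPoly (m : ℕ) (k : ℕ → ℂ) : Polynomial ℂ :=
  (-1 : Polynomial ℂ) ^ m *
    (triDet m k - Polynomial.C (k (m - 1)) * triDet (m - 2) fun j => k (j + 1))

/-- The space `ℓ²(ℤ; ℂ)`. -/
abbrev Ell2Z : Type := lp (fun _ : ℤ => ℂ) 2

/-- `A` is the hopping operator `A^c` associated to the sequence `c`:
`(A x)(i) = x(i+1) + c(i)·x(i−1)`. -/
def IsHopping (c : ℤ → ℂ) (A : Ell2Z →L[ℂ] Ell2Z) : Prop :=
  ∀ x : Ell2Z, ∀ i : ℤ, A x i = x (i + 1) + c i * x (i - 1)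

/-- The `(i,j)` matrix entry of an operator `T` on `ℓ²(ℤ; ℂ)`: `T_{i,j} = (T e_j)(i)`. -/
noncomputable def entry (T : Ell2Z →L[ℂ] Ell2Z) (i j : ℤ) : ℂ :=
  T (lp.single 2 j (1 : ℂ)) i

theorem entry_one (i j : ℤ) :
    entry 1 i j = if i = j then 1 else 0 := by
  simp only [entry, one_apply_eq_self, lp.single_apply, Pi.single_apply]

theorem IsHopping.entry_pow_succ {c : ℤ → ℂ} {A : Ell2Z →L[ℂ] Ell2Z} (hA : IsHopping c A)
    (s : ℕ) (i j : ℤ) :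
    entry (A ^ (s + 1)) i j = entry (A ^ s) (i + 1) j + c i * entry (A ^ s) (i - 1) j := by
  rw [pow_succ']
  exact hA _ i

theorem IsHopping.entry_pow_eq_zero {c : ℤ → ℂ} {A : Ell2Z →L[ℂ] Ell2Z} (hA : IsHopping c A)
    (s : ℕ) (i j : ℤ) (hj : ∀ t : ℕ, t ≤ s → j ≠ i - (s : ℤ) + 2 * (t : ℤ)) :
    entry (A ^ s) i j = 0 := by
  induction s generalizing i with
  | zero =>
    rw [pow_zero, entry_one, if_neg]
    have := hj 0 le_rfl
    omega
  | succ s ih =>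
    rw [hA.entry_pow_succ, ih (i + 1), ih (i - 1), mul_zero, add_zero]
    · intro t ht
      have := hj t (by omega)
      omega
    · intro t ht
      have := hj (t + 1) (by omega)
      omega

theorem IsHopping.entry_pow_add_self {c : ℤ → ℂ} {A : Ell2Z →L[ℂ] Ell2Z} (hA : IsHopping c A)
    (s : ℕ) (i : ℤ) : entry (A ^ s) i (i + (s : ℤ)) = 1 := by
  induction s generalizing i with
  | zero => simp [entry_one]
  | succ s ih =>
    have h : i + ((s + 1 : ℕ) : ℤ) = i + 1 + (s : ℤ) := by omega
    rw [hA.entry_pow_succ, hA.entry_pow_eq_zero s (i - 1) _ (by intro t ht; omega), h, ih,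
      mul_zero, add_zero]

/-- `((A^c)^s)_{i,i+s} = 1`, and `((A^c)^s)_{i,j} = 0` whenever `j` is not of
the form `i − s + 2t` with `t ∈ {0, …, s}`. -/
theorem stmt_7 (c : ℤ → ℂ) (hc : ∀ i, c i = 1 ∨ c i = -1)
    (A : Ell2Z →L[ℂ] Ell2Z) (hA : IsHopping c A) (s : ℕ) (hs : 1 ≤ s) (i : ℤ) :
    entry (A ^ s) i (i + (s : ℤ)) = 1 ∧
    ∀ j : ℤ, (∀ t : ℕ, t ≤ s → j ≠ i - (s : ℤ) + 2 * (t : ℤ)) → entry (A ^ s) i j = 0 := by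
  exact ⟨hA.entry_pow_add_self s i, hA.entry_pow_eq_zero s i⟩
end

section
/- Let m ≥ 2. (i) Let k = (k_1, …, k_m) be given by k_j = 1 for 1 ≤ j ≤ m−2, k_{m−1} = −1, k_m = 1, and let k̂ = (k_1, …, k_{m−2}, 1, −1). Then p_k = p_{k̂} as polynomials; in particular k generates a symmetry. (ii) Let k = (k_1, …, k_m) be given by k_j = −1 for 1 ≤ j ≤ m−1, k_m = 1, and let k̂ = (k_1, …, k_{m−2}, 1, −1). Then p_k = p_{k̂} as polynomials; in particular k generates a symmetry. Consequently, for every m ≥ 2 there exists at least one m-tuple generating a symmetry. -/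
open scoped BigOperators

/-- The tuple `k̂ = (k_1, …, k_{m−2}, 1, −1)` obtained from `k` by replacing the last two
entries (0-based positions `m-2` and `m-1`) by `1` and `-1`. -/
noncomputable def khat (m : ℕ) (k : ℕ → ℂ) : ℕ → ℂ :=
  fun j => if j = m - 2 then 1 else if j = m - 1 then -1 else k j

/-- `k` generates a symmetry: `k_{m−1} = −1`, `k_m = 1` and `p_k = p_k̂`. -/
def GeneratesSymmetry (m : ℕ) (k : ℕ → ℂ) : Prop :=
  k (m - 2) = -1 ∧ k (m - 1) = 1 ∧ pPoly m k = pPoly m (khat m k)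

theorem triDet_congr {n : ℕ} {a b : ℕ → ℂ} (h : ∀ j, j + 1 < n → a j = b j) :
    triDet n a = triDet n b := by
  unfold triDet
  congr 1
  ext1 i j
  simp only [Matrix.of_apply]
  split_ifs with h1 h2 h3
  · rfl
  · rfl
  · rw [h j (by omega)]
  · rfl

theorem triDet_add_two (n : ℕ) (a : ℕ → ℂ) :
    triDet (n + 2) a =
      -Polynomial.X * triDet (n + 1) a - Polynomial.C (a n) * triDet n a := by
  have hlast : (Fin.last n).castSucc.succAbove (Fin.last n) = Fin.last (n + 1) := by
    rw [Fin.succAbove_castSucc_self, Fin.succ_last]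
  unfold triDet
  rw [Matrix.det_succ_row _ (Fin.last (n + 1)), Fin.sum_univ_castSucc, Fin.sum_univ_castSucc,
    Finset.sum_eq_zero]
  · rw [Matrix.det_succ_column (Matrix.submatrix _ (Fin.last (n + 1)).succAbove
      (Fin.last n).castSucc.succAbove) (Fin.last n), Fin.sum_univ_castSucc, Finset.sum_eq_zero]
    · have hcast (j : Fin n) :
          (Fin.last n).castSucc.succAbove j.castSucc = j.castSucc.castSucc :=
        Fin.succAbove_of_castSucc_lt _ _ (by simp [Fin.lt_def])
      simp only [Matrix.submatrix, Matrix.of_apply, Fin.succAbove_last, hlast, hcast,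
        Fin.val_castSucc, Fin.val_last, ← two_mul, pow_mul, neg_one_sq, one_pow,
        pow_add, pow_one, if_true]
      have hsq : ((-1 : Polynomial ℂ) ^ n) * (-1) ^ n = 1 := by
        rw [← mul_pow]; simp
      simp [hsq, show n + 1 + 1 ≠ n by omega]
      ring
    · intro i _
      have hi := i.isLt
      simp only [Matrix.submatrix_apply, Matrix.of_apply, Fin.succAbove_last, hlast,
        Fin.val_castSucc, Fin.val_last]
      rw [if_neg (by omega), if_neg (by omega), if_neg (by omega)]
      simp
  · intro j _
    have hj := j.isLt
    simp only [Matrix.of_apply, Fin.val_castSucc, Fin.val_last]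
    rw [if_neg (by omega), if_neg (by omega), if_neg (by omega)]
    simp

theorem generatesSymmetry_of_const {n : ℕ} {k : ℕ → ℂ} {c : ℂ} (hc : ∀ j < n, k j = c)
    (hn : k n = -1) (hn1 : k (n + 1) = 1) : GeneratesSymmetry (n + 2) k := by
  refine ⟨hn, hn1, ?_⟩
  have hhat : ∀ j < n, khat (n + 2) k j = k j := fun j hj => by
    simp only [khat]
    rw [if_neg (by omega), if_neg (by omega)]
  have hhatn : khat (n + 2) k n = 1 := by simp [khat]
  have hhatn1 : khat (n + 2) k (n + 1) = -1 := by simp [khat]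
  have h1 : triDet (n + 1) (khat (n + 2) k) = triDet (n + 1) k :=
    triDet_congr fun j hj => hhat j (by omega)
  have h2 : triDet n (khat (n + 2) k) = triDet n k :=
    triDet_congr fun j hj => hhat j (by omega)
  have h3 : triDet n (fun j => khat (n + 2) k (j + 1)) = triDet n k :=
    triDet_congr fun j hj => by
      rw [hhat _ hj, hc _ hj, hc j (by omega)]
  have h4 : triDet n (fun j => k (j + 1)) = triDet n k :=
    triDet_congr fun j hj => by rw [hc _ hj, hc j (by omega)]
  simp only [pPoly, Nat.add_sub_cancel, show n + 2 - 1 = n + 1 from rfl]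
  rw [triDet_add_two, triDet_add_two, h1, h2, h3, h4, hn, hn1, hhatn, hhatn1]
  simp only [map_neg, map_one]
  ring

/-- the tuples `(1, …, 1, −1, 1)` and `(−1, …, −1, −1, 1)` generate
symmetries; in particular for every `m ≥ 2` there is an `m`-tuple generating a symmetry. -/
theorem stmt_17 (m : ℕ) (hm : 2 ≤ m) :
    GeneratesSymmetry m (fun j => if j = m - 2 then (-1 : ℂ) else 1) ∧
    GeneratesSymmetry m (fun j => if j = m - 1 then (1 : ℂ) else -1) ∧
    ∃ k : ℕ → ℂ, (∀ j, k j = 1 ∨ k j = -1) ∧ GeneratesSymmetry m k := by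
  obtain ⟨n, rfl⟩ := Nat.exists_eq_add_of_le' hm
  have hneg : GeneratesSymmetry (n + 2) (fun j => if j = n + 2 - 1 then (1 : ℂ) else -1) :=
    generatesSymmetry_of_const (c := -1) (fun j hj => if_neg (by omega)) (if_neg (by omega))
      (if_pos rfl)
  refine ⟨generatesSymmetry_of_const (c := 1) (fun j hj => if_neg (by omega)) (if_pos rfl)
    (if_neg (by omega)), hneg, _, fun j => ?_, hneg⟩
  exact ite_eq_or_eq _ _ _
end
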